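/- A linear endomorphism of u(2) ⊕ u(2) is a Lie algebra automorphism if and only if it belongs to H ∪ τH, where H is the set of linear maps Φ with Φ(J_k⁽¹⁾) = Φ₁J_k⁽¹⁾ and Φ(J_k⁽²⁾) = Φ₄J_k⁽²⁾ for k = 1,2,3, for some Φ₁, Φ₄ ∈ SO(3), and Φ(J₄⁽¹⁾) = b₁₁J₄⁽¹⁾ + b₂₁J₄⁽²⁾, Φ(J₄⁽²⁾) = b₁₂J₄⁽¹⁾ + b₂₂J₄⁽²⁾ with b₁₁b₂₂ − b₁₂b₂₁ ≠ 0, and τ is the swap of the two u(2) factors. Moreover H and τH are disjoint. -/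

import Mathlib

/-- The cross product on ℝ³. -/
def cross (x y : Fin 3 → ℝ) : Fin 3 → ℝ :=
  ![x 1 * y 2 - x 2 * y 1, x 2 * y 0 - x 0 * y 2, x 0 * y 1 - x 1 * y 0]

/-- `R` is a special orthogonal 3×3 matrix. -/
def so3 (R : Matrix (Fin 3) (Fin 3) ℝ) : Prop := R * R.transpose = 1 ∧ R.det = 1

/-- u(2) modelled on ℝ³ ⊕ ℝ. -/
abbrev U2 : Type := (Fin 3 → ℝ) × ℝ

/-- The componentwise Lie bracket of u(2) ⊕ u(2). -/
def braU2U2 (x y : U2 × U2) : U2 × U2 :=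
  ((cross x.1.1 y.1.1, 0), (cross x.2.1 y.2.1, 0))

/-- `Φ` belongs to the subgroup H: it acts by Φ₁ ∈ SO(3) and Φ₄ ∈ SO(3) on the two su(2)
factors and by an invertible 2×2 matrix (b₁₁,b₁₂;b₂₁,b₂₂) on the two centers. -/
def inH (Φ : (U2 × U2) →ₗ[ℝ] (U2 × U2)) : Prop :=
  ∃ (Φ₁ Φ₄ : Matrix (Fin 3) (Fin 3) ℝ) (b11 b12 b21 b22 : ℝ),
    so3 Φ₁ ∧ so3 Φ₄ ∧ b11 * b22 - b12 * b21 ≠ 0 ∧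
    ∀ (x y : Fin 3 → ℝ) (a b : ℝ),
      Φ ((x, a), (y, b)) = ((Φ₁.mulVec x, b11 * a + b12 * b), (Φ₄.mulVec y, b21 * a + b22 * b))

/-- `Φ` belongs to the coset τH, τ the swap of the two u(2) factors. -/
def inTauH (Φ : (U2 × U2) →ₗ[ℝ] (U2 × U2)) : Prop :=
  ∃ (Φ₂ Φ₃ : Matrix (Fin 3) (Fin 3) ℝ) (b11 b12 b21 b22 : ℝ),
    so3 Φ₂ ∧ so3 Φ₃ ∧ b11 * b22 - b12 * b21 ≠ 0 ∧
    ∀ (x y : Fin 3 → ℝ) (a b : ℝ),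
      Φ ((x, a), (y, b)) = ((Φ₂.mulVec y, b11 * a + b12 * b), (Φ₃.mulVec x, b21 * a + b22 * b))

open Matrix

theorem cross_mulVec (M : Matrix (Fin 3) (Fin 3) ℝ) (x y : Fin 3 → ℝ) :
    cross (M *ᵥ x) (M *ᵥ y) = M.adjugateᵀ *ᵥ cross x y := by
  ext i
  fin_cases i <;>
    simp [cross, Matrix.adjugate_fin_three, Matrix.mulVec, dotProduct, Fin.sum_univ_three] <;> ring

theorem exists_cross_eq_single (i : Fin 3) :
    ∃ x y : Fin 3 → ℝ, cross x y = Pi.single i 1 := by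
  fin_cases i
  · exact ⟨![0, 1, 0], ![0, 0, 1], by ext j; fin_cases j <;> simp [cross]⟩
  · exact ⟨![0, 0, 1], ![1, 0, 0], by ext j; fin_cases j <;> simp [cross]⟩
  · exact ⟨![1, 0, 0], ![0, 1, 0], by ext j; fin_cases j <;> simp [cross]⟩

/-- Linear maps agreeing on all cross products agree. -/
theorem linearMap_ext_cross {E : Type*} [AddCommGroup E] [Module ℝ E]
    {f g : (Fin 3 → ℝ) →ₗ[ℝ] E} (h : ∀ x y, f (cross x y) = g (cross x y)) : f = g := by
  refine LinearMap.pi_ext' fun i => LinearMap.ext_ring ?_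
  obtain ⟨x, y, hxy⟩ := exists_cross_eq_single i
  simpa [hxy] using h x y

theorem eq_zero_of_forall_cross_eq_zero {x : Fin 3 → ℝ} (h : ∀ y, cross x y = 0) : x = 0 := by
  have h₀ := h ![1, 0, 0]
  have h₁ := h ![0, 1, 0]
  have e1 := congrFun h₀ 1
  have e2 := congrFun h₀ 2
  have e0 := congrFun h₁ 2
  simp [cross] at e0 e1 e2
  ext i
  fin_cases i <;> simp [e0, e1, e2]

theorem so3.cross_mulVec {R : Matrix (Fin 3) (Fin 3) ℝ} (hR : so3 R) (x y : Fin 3 → ℝ) :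
    R *ᵥ cross x y = cross (R *ᵥ x) (R *ᵥ y) := by
  have h : R.adjugate = Rᵀ := by
    calc R.adjugate = R.adjugate * (R * Rᵀ) := by rw [hR.1, mul_one]
      _ = Rᵀ := by rw [← mul_assoc, adjugate_mul, hR.2, one_smul, one_mul]
  rw [_root_.cross_mulVec, h, transpose_transpose]

theorem so3.transpose_mulVec_mulVec {R : Matrix (Fin 3) (Fin 3) ℝ} (hR : so3 R)
    (x : Fin 3 → ℝ) : Rᵀ *ᵥ (R *ᵥ x) = x := by
  rw [mulVec_mulVec, mul_eq_one_comm.mp hR.1, one_mulVec]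

theorem so3.mulVec_transpose_mulVec {R : Matrix (Fin 3) (Fin 3) ℝ} (hR : so3 R)
    (x : Fin 3 → ℝ) : R *ᵥ (Rᵀ *ᵥ x) = x := by
  rw [mulVec_mulVec, hR.1, one_mulVec]

/-- An endomorphism of the cross product algebra is zero or a rotation. -/
theorem eq_zero_or_so3 {f : (Fin 3 → ℝ) →ₗ[ℝ] (Fin 3 → ℝ)}
    (hf : ∀ x y, f (cross x y) = cross (f x) (f y)) :
    f = 0 ∨ ∃ R, so3 R ∧ ∀ x, f x = R *ᵥ x := by
  set M := LinearMap.toMatrix' f with hM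
  have hfM : ∀ x, f x = M *ᵥ x := fun x => by rw [hM, LinearMap.toMatrix'_mulVec]
  have hfadj : f = toLin' M.adjugateᵀ := linearMap_ext_cross fun x y => by
    rw [hf, hfM, hfM, cross_mulVec, toLin'_apply]
  have hadj : Mᵀ = M.adjugate := by
    rw [hM, ← transpose_inj, transpose_transpose, ← hM]
    conv_lhs => rw [hM, hfadj]
    exact LinearMap.toMatrix'_toLin' _
  have hmul : M * Mᵀ = M.det • (1 : Matrix (Fin 3) (Fin 3) ℝ) := by rw [hadj, mul_adjugate]
  have hdet : M.det * M.det = M.det ^ 3 := by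
    have := congrArg det hmul
    simpa [det_mul, det_transpose] using this
  by_cases hd : M.det = 0
  · left
    rw [hd, zero_smul] at hmul
    have hM0 : M = 0 := by
      apply self_mul_conjTranspose_eq_zero.mp
      simpa [conjTranspose_eq_transpose_of_trivial] using hmul
    ext1 i
    ext
    simp [hfM, hM0]
  · right
    have hd1 : M.det = 1 := by
      have : M.det * M.det * (M.det - 1) = 0 := by linear_combination -hdet
      simpa [hd, sub_eq_zero] using this
    exact ⟨M, ⟨by rw [hmul, hd1, one_smul], hd1⟩, hfM⟩

/-- `Φ` is a Lie algebra automorphism of u(2) ⊕ u(2). -/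
def IsAut (Φ : (U2 × U2) →ₗ[ℝ] (U2 × U2)) : Prop :=
  Function.Bijective Φ ∧ ∀ x y, Φ (braU2U2 x y) = braU2U2 (Φ x) (Φ y)

/-- `Φ` followed by the swap of the two u(2) factors. -/
def swapComp (Φ : (U2 × U2) →ₗ[ℝ] (U2 × U2)) : (U2 × U2) →ₗ[ℝ] (U2 × U2) :=
  (LinearEquiv.prodComm ℝ U2 U2).toLinearMap ∘ₗ Φ

theorem swapComp_apply (Φ : (U2 × U2) →ₗ[ℝ] (U2 × U2)) (x : U2 × U2) :
    swapComp Φ x = (Φ x).swap := rfl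

theorem swapComp_swapComp (Φ : (U2 × U2) →ₗ[ℝ] (U2 × U2)) : swapComp (swapComp Φ) = Φ :=
  LinearMap.ext fun _ => rfl

theorem IsAut.swapComp {Φ : (U2 × U2) →ₗ[ℝ] (U2 × U2)} (h : IsAut Φ) :
    IsAut (swapComp Φ) :=
  ⟨(LinearEquiv.prodComm ℝ U2 U2).bijective.comp h.1, fun x y => by
    rw [swapComp_apply, h.2]; rfl⟩

theorem inTauH_iff_inH_swapComp (Φ : (U2 × U2) →ₗ[ℝ] (U2 × U2)) :
    inTauH Φ ↔ inH (swapComp Φ) := by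
  constructor
  · rintro ⟨P, Q, a, b, c, d, hP, hQ, hdet, h⟩
    refine ⟨Q, P, c, d, a, b, hQ, hP, fun h0 => hdet (by linear_combination -h0), ?_⟩
    intro x y s t
    rw [swapComp_apply, h]; rfl
  · rintro ⟨P, Q, a, b, c, d, hP, hQ, hdet, h⟩
    refine ⟨Q, P, c, d, a, b, hQ, hP, fun h0 => hdet (by linear_combination -h0), ?_⟩
    intro x y s t
    rw [← swapComp_swapComp Φ, swapComp_apply, h]; rfl

theorem inH.isAut {Φ : (U2 × U2) →ₗ[ℝ] (U2 × U2)} (h : inH Φ) : IsAut Φ := by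
  obtain ⟨P, Q, a, b, c, d, hP, hQ, hdet, h⟩ := h
  refine ⟨Function.bijective_iff_has_inverse.mpr
    ⟨fun v => ((Pᵀ *ᵥ v.1.1, (d * v.1.2 - b * v.2.2) / (a * d - b * c)),
      (Qᵀ *ᵥ v.2.1, (a * v.2.2 - c * v.1.2) / (a * d - b * c))), ?_, ?_⟩, ?_⟩
  · rintro ⟨⟨x, s⟩, ⟨y, t⟩⟩
    simp only [h, hP.transpose_mulVec_mulVec, hQ.transpose_mulVec_mulVec, Prod.mk.injEq, true_and]
    constructor <;> rw [div_eq_iff hdet] <;> ring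
  · rintro ⟨⟨x, s⟩, ⟨y, t⟩⟩
    simp only [h, hP.mulVec_transpose_mulVec, hQ.mulVec_transpose_mulVec, Prod.mk.injEq, true_and]
    constructor <;> rw [← mul_div_assoc, ← mul_div_assoc, ← add_div, div_eq_iff hdet] <;> ring
  · rintro ⟨⟨x, s⟩, ⟨y, t⟩⟩ ⟨⟨x', s'⟩, ⟨y', t'⟩⟩
    simp [braU2U2, h, hP.cross_mulVec, hQ.cross_mulVec]

theorem cross_zero_left (x : Fin 3 → ℝ) : cross 0 x = 0 := by
  ext i; fin_cases i <;> simp [cross]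

theorem cross_zero_right (x : Fin 3 → ℝ) : cross x 0 = 0 := by
  ext i; fin_cases i <;> simp [cross]

theorem IsAut.map_center {Φ : (U2 × U2) →ₗ[ℝ] (U2 × U2)} (h : IsAut Φ) (a b : ℝ) :
    (Φ ((0, a), (0, b))).1.1 = 0 ∧ (Φ ((0, a), (0, b))).2.1 = 0 := by
  have key : ∀ w, braU2U2 (Φ ((0, a), (0, b))) w = 0 := fun w => by
    obtain ⟨v, rfl⟩ := h.1.2 w
    rw [← h.2]
    simp only [braU2U2, cross_zero_left]
    exact map_zero Φ
  exact ⟨eq_zero_of_forall_cross_eq_zero fun y =>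
      congrArg (fun v : U2 × U2 => v.1.1) (key ((y, 0), (0, 0))),
    eq_zero_of_forall_cross_eq_zero fun y =>
      congrArg (fun v : U2 × U2 => v.2.1) (key ((0, 0), (y, 0)))⟩

/-- The inclusion of the first su(2) factor. -/
def inFst : (Fin 3 → ℝ) →ₗ[ℝ] U2 × U2 := LinearMap.inl ℝ U2 U2 ∘ₗ LinearMap.inl ℝ _ ℝ

/-- The inclusion of the second su(2) factor. -/
def inSnd : (Fin 3 → ℝ) →ₗ[ℝ] U2 × U2 := LinearMap.inr ℝ U2 U2 ∘ₗ LinearMap.inl ℝ _ ℝ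

/-- The projection onto the first su(2) factor. -/
def prFst : U2 × U2 →ₗ[ℝ] (Fin 3 → ℝ) := LinearMap.fst ℝ _ ℝ ∘ₗ LinearMap.fst ℝ U2 U2

/-- The projection onto the second su(2) factor. -/
def prSnd : U2 × U2 →ₗ[ℝ] (Fin 3 → ℝ) := LinearMap.fst ℝ _ ℝ ∘ₗ LinearMap.snd ℝ U2 U2

/-- The projection onto the center. -/
def prCenter : U2 × U2 →ₗ[ℝ] ℝ × ℝ :=
  LinearMap.prodMap (LinearMap.snd ℝ (Fin 3 → ℝ) ℝ) (LinearMap.snd ℝ (Fin 3 → ℝ) ℝ)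

theorem ext_of_projections {v w : U2 × U2} (h₁ : prFst v = prFst w) (h₂ : prSnd v = prSnd w)
    (h₃ : prCenter v = prCenter w) : v = w :=
  Prod.ext (Prod.ext h₁ (Prod.ext_iff.mp h₃).1) (Prod.ext h₂ (Prod.ext_iff.mp h₃).2)

theorem inFst_cross (x y : Fin 3 → ℝ) : inFst (cross x y) = braU2U2 (inFst x) (inFst y) := by
  simp [inFst, braU2U2, cross_zero_left, Prod.mk_zero_zero]

theorem inSnd_cross (x y : Fin 3 → ℝ) : inSnd (cross x y) = braU2U2 (inSnd x) (inSnd y) := by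
  simp [inSnd, braU2U2, cross_zero_left, Prod.mk_zero_zero]

theorem braU2U2_inFst_inSnd (x y : Fin 3 → ℝ) : braU2U2 (inFst x) (inSnd y) = 0 := by
  simp [inFst, inSnd, braU2U2, cross_zero_left, cross_zero_right]

theorem IsAut.prCenter_comp_eq_zero {Φ : (U2 × U2) →ₗ[ℝ] (U2 × U2)} (h : IsAut Φ)
    {i : (Fin 3 → ℝ) →ₗ[ℝ] U2 × U2} (hi : ∀ x y, i (cross x y) = braU2U2 (i x) (i y)) :
    prCenter ∘ₗ Φ ∘ₗ i = 0 :=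
  linearMap_ext_cross fun x y => by
    rw [LinearMap.comp_apply, LinearMap.comp_apply, hi, h.2]; rfl

theorem IsAut.inH_of_ne_zero {Φ : (U2 × U2) →ₗ[ℝ] (U2 × U2)} (h : IsAut Φ)
    (hA : prFst ∘ₗ Φ ∘ₗ inFst ≠ 0) : inH Φ := by
  have hcF := h.prCenter_comp_eq_zero inFst_cross
  have hcS := h.prCenter_comp_eq_zero inSnd_cross
  obtain ⟨P, hP, hPA⟩ := (eq_zero_or_so3 (f := prFst ∘ₗ Φ ∘ₗ inFst) fun x y => by
    simp only [LinearMap.comp_apply, inFst_cross, h.2]; rfl).resolve_left hA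
  have hbra : ∀ x y, braU2U2 (Φ (inFst x)) (Φ (inSnd y)) = 0 := fun x y => by
    rw [← h.2, braU2U2_inFst_inSnd, map_zero]
  have hB : ∀ y, prFst (Φ (inSnd y)) = 0 := fun y => by
    have key : ∀ x, cross x (prFst (Φ (inSnd y))) = 0 := fun x => by
      have := congrArg prFst (hbra (Pᵀ *ᵥ x) y)
      have hx := hPA (Pᵀ *ᵥ x)
      rw [hP.mulVec_transpose_mulVec] at hx
      rw [← hx]
      exact this
    refine eq_zero_of_forall_cross_eq_zero fun x => ?_
    have hk := key x
    ext i
    have := congrFun hk i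
    fin_cases i <;> simp [cross] at this ⊢ <;> linear_combination -this
  have hD : prSnd ∘ₗ Φ ∘ₗ inSnd ≠ 0 := fun hD => by
    have h0 : Φ (inSnd (Pi.single 0 1)) = Φ 0 := by
      rw [map_zero]
      have e1 := hB (Pi.single 0 1)
      have e2 := LinearMap.congr_fun hD (Pi.single 0 1)
      have e3 := LinearMap.congr_fun hcS (Pi.single 0 1)
      exact ext_of_projections e1 e2 e3
    have := congrFun (congrArg prSnd (h.1.1 h0)) 0
    simp [prSnd, inSnd] at this
  obtain ⟨Q, hQ, hQD⟩ := (eq_zero_or_so3 (f := prSnd ∘ₗ Φ ∘ₗ inSnd) fun x y => by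
    simp only [LinearMap.comp_apply, inSnd_cross, h.2]; rfl).resolve_left hD
  have hC : ∀ x, prSnd (Φ (inFst x)) = 0 := fun x =>
    eq_zero_of_forall_cross_eq_zero fun y => by
      have := congrArg prSnd (hbra x (Qᵀ *ᵥ y))
      have hy := hQD (Qᵀ *ᵥ y)
      rw [hQ.mulVec_transpose_mulVec] at hy
      rw [← hy]
      exact this
  set u := Φ ((0, 1), (0, 0)) with hu
  set v := Φ ((0, 0), (0, 1)) with hv
  have hcenter : ∀ a b : ℝ, Φ ((0, a), (0, b)) =
      ((0, u.1.2 * a + v.1.2 * b), (0, u.2.2 * a + v.2.2 * b)) := fun a b => by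
    have hsplit : (((0, a), (0, b)) : U2 × U2) =
        a • ((0, 1), (0, 0)) + b • ((0, 0), (0, 1)) := by simp
    refine Prod.ext (Prod.ext (h.map_center a b).1 ?_) (Prod.ext (h.map_center a b).2 ?_) <;>
      rw [hsplit, map_add, map_smul, map_smul, ← hu, ← hv] <;> simp <;> ring
  have hinj : ∀ a b : ℝ, u.1.2 * a + v.1.2 * b = 0 → u.2.2 * a + v.2.2 * b = 0 →
      a = 0 ∧ b = 0 := fun a b h₁ h₂ => by
    have h0 : Φ ((0, a), (0, b)) = Φ 0 := by rw [hcenter, h₁, h₂, map_zero]; rfl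
    have := h.1.1 h0
    exact ⟨congrArg (fun w : U2 × U2 => w.1.2) this, congrArg (fun w : U2 × U2 => w.2.2) this⟩
  refine ⟨P, Q, u.1.2, v.1.2, u.2.2, v.2.2, hP, hQ, fun hdet => ?_, fun x y a b => ?_⟩
  · obtain ⟨e1, e2⟩ := hinj v.2.2 (-u.2.2) (by linear_combination hdet) (by ring)
    obtain ⟨e3, e4⟩ := hinj v.1.2 (-u.1.2) (by ring) (by linear_combination -hdet)
    exact one_ne_zero (hinj 1 0 (by linear_combination -e4) (by linear_combination -e2)).1
  · have hsplit : (((x, a), (y, b)) : U2 × U2) = inFst x + inSnd y + ((0, a), (0, b)) := by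
      simp [inFst, inSnd]
    have hx : Φ (inFst x) = ((P *ᵥ x, 0), (0, 0)) :=
      ext_of_projections (hPA x) (hC x) (LinearMap.congr_fun hcF x)
    have hy : Φ (inSnd y) = ((0, 0), (Q *ᵥ y, 0)) :=
      ext_of_projections (hB y) (hQD y) (LinearMap.congr_fun hcS y)
    rw [hsplit, map_add, map_add, hx, hy, hcenter]
    simp

theorem IsAut.inH_or_inTauH {Φ : (U2 × U2) →ₗ[ℝ] (U2 × U2)} (h : IsAut Φ) :
    inH Φ ∨ inTauH Φ := by
  by_cases hA : prFst ∘ₗ Φ ∘ₗ inFst = 0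
  · right
    refine (inTauH_iff_inH_swapComp Φ).mpr (h.swapComp.inH_of_ne_zero fun hC => ?_)
    have h0 : Φ (inFst (Pi.single 0 1)) = Φ 0 := by
      rw [map_zero]
      have e1 := LinearMap.congr_fun hA (Pi.single 0 1)
      have e2 := LinearMap.congr_fun hC (Pi.single 0 1)
      have e3 := LinearMap.congr_fun (h.prCenter_comp_eq_zero inFst_cross) (Pi.single 0 1)
      exact ext_of_projections e1 e2 e3
    have := congrFun (congrArg prFst (h.1.1 h0)) 0
    simp [prFst, inFst] at this
  · exact Or.inl (h.inH_of_ne_zero hA)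

theorem inH.not_inTauH {Φ : (U2 × U2) →ₗ[ℝ] (U2 × U2)} (h : inH Φ) : ¬ inTauH Φ := by
  obtain ⟨P, _, a, b, c, d, hP, _, _, h⟩ := h
  rintro ⟨Q, _, a', b', c', d', _, _, _, h'⟩
  have h0 : P *ᵥ Pi.single 0 1 = 0 := by
    have := congrArg (fun v : U2 × U2 => v.1.1)
      ((h (Pi.single 0 1) 0 0 0).symm.trans (h' (Pi.single 0 1) 0 0 0))
    simpa only [mulVec_zero] using this
  have h1 := hP.transpose_mulVec_mulVec (Pi.single 0 1)
  rw [h0, mulVec_zero] at h1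
  simpa using congrFun h1 0

/-- A linear endomorphism of u(2) ⊕ u(2) is a Lie algebra automorphism iff it belongs to
H ∪ τH; moreover H and τH are disjoint. -/
theorem stmt16 :
    (∀ Φ : (U2 × U2) →ₗ[ℝ] (U2 × U2),
      (Function.Bijective Φ ∧ ∀ x y, Φ (braU2U2 x y) = braU2U2 (Φ x) (Φ y)) ↔
        (inH Φ ∨ inTauH Φ)) ∧
    (∀ Φ : (U2 × U2) →ₗ[ℝ] (U2 × U2), ¬(inH Φ ∧ inTauH Φ)) := by
  refine ⟨fun Φ => ⟨fun h => IsAut.inH_or_inTauH h, ?_⟩, fun Φ h => h.1.not_inTauH h.2⟩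
  rintro (h | h)
  · exact h.isAut
  · have := ((inTauH_iff_inH_swapComp Φ).mp h).isAut.swapComp
    rwa [swapComp_swapComp] at this
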